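/- arXiv:1709.08014 — 3 statements merged into one kernel-verified Lean document; each statement's English description precedes it below -/
import Mathlib

section
/- Let n ≥ 0 and let C be a positive-definite Hermitian (n+1)×(n+1) complex matrix. For w ∈ ℂⁿ let v(w) ∈ ℂ^{n+1} denote the vector with components v(w)_0 = 1 and v(w)_i = w_i for 1 ≤ i ≤ n. Then the function w ↦ (v(w)* C v(w))^{-(n+1)} is integrable on ℂⁿ and ∫_{ℂⁿ} (v(w)* C v(w))^{-(n+1)} dλ(w) = πⁿ / (n! · det C). (Here v* denotes conjugate transpose; v(w)* C v(w) and det C are positive real numbers.) -/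
open MeasureTheory Matrix
open scoped ComplexOrder

/-- The Schur complement of the last diagonal entry of a matrix. -/
noncomputable def schurLast {m : ℕ} (C : Matrix (Fin (m + 1)) (Fin (m + 1)) ℂ) :
    Matrix (Fin m) (Fin m) ℂ :=
  Matrix.of fun i j => C i.castSucc j.castSucc -
    C i.castSucc (Fin.last m) * (C (Fin.last m) (Fin.last m))⁻¹ * C (Fin.last m) j.castSucc

theorem det_eq_mul_det_schurLast {m : ℕ} (C : Matrix (Fin (m + 1)) (Fin (m + 1)) ℂ)
    (h : C (Fin.last m) (Fin.last m) ≠ 0) :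
    C.det = C (Fin.last m) (Fin.last m) * (schurLast C).det := by
  set a := C (Fin.last m) (Fin.last m) with ha
  let D : Matrix (Fin 1) (Fin 1) ℂ := Matrix.of fun _ _ => a
  let D' : Matrix (Fin 1) (Fin 1) ℂ := Matrix.of fun _ _ => a⁻¹
  let _ : Invertible D :=
    ⟨D', by ext i j; fin_cases i; fin_cases j; simp [D, D', Matrix.mul_apply, h],
      by ext i j; fin_cases i; fin_cases j; simp [D, D', Matrix.mul_apply, h]⟩
  have hblock : C.submatrix finSumFinEquiv finSumFinEquiv =
      fromBlocks (Matrix.of fun i j => C (Fin.castSucc i) (Fin.castSucc j))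
        (Matrix.of fun i _ => C (Fin.castSucc i) (Fin.last m))
        (Matrix.of fun _ j => C (Fin.last m) (Fin.castSucc j)) D := by
    have hl : Fin.natAdd m (0 : Fin 1) = Fin.last m := rfl
    have hc : ∀ i : Fin m, Fin.castAdd 1 i = Fin.castSucc i := fun _ => rfl
    ext i j
    rcases i with i | i <;> rcases j with j | j <;>
      simp [D, ha, hl, hc, Subsingleton.elim _ (0 : Fin 1)]
  rw [← det_submatrix_equiv_self finSumFinEquiv C, hblock, det_fromBlocks₂₂]
  have hD : D.det = a := by simp [D]
  rw [hD]
  congr 2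
  ext i j
  have : ⅟D = D' := rfl
  simp [this, D', schurLast, Matrix.mul_apply, ha]

/-- Completing the square in the last variable of a Hermitian form. -/
theorem star_dotProduct_mulVec_snoc {m : ℕ} {C : Matrix (Fin (m + 1)) (Fin (m + 1)) ℂ}
    (hC : C.IsHermitian) (h : C (Fin.last m) (Fin.last m) ≠ 0) (x : Fin m → ℂ) (z : ℂ) :
    star (Fin.snoc x z : Fin (m + 1) → ℂ) ⬝ᵥ C *ᵥ (Fin.snoc x z : Fin (m + 1) → ℂ) =
      C (Fin.last m) (Fin.last m) *
        ((‖z + (∑ j, C (Fin.last m) j.castSucc * x j) / C (Fin.last m) (Fin.last m)‖ ^ 2 : ℝ) : ℂ)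
      + star x ⬝ᵥ schurLast C *ᵥ x := by
  set a := C (Fin.last m) (Fin.last m) with ha
  set b := ∑ j, C (Fin.last m) j.castSucc * x j with hb
  have hsa : star a = a := hC.apply _ _
  have hsb : star b = ∑ i, star (x i) * C i.castSucc (Fin.last m) := by
    simp only [hb, star_sum, star_mul]
    exact Finset.sum_congr rfl fun i _ => by rw [hC.apply]
  have hS : star x ⬝ᵥ schurLast C *ᵥ x =
      (∑ i, star (x i) * ∑ j, C i.castSucc j.castSucc * x j) - star b * a⁻¹ * b := by
    rw [hsb, hb, Finset.sum_mul, Finset.sum_mul, ← Finset.sum_sub_distrib]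
    refine Finset.sum_congr rfl fun i _ => ?_
    simp only [Pi.star_apply, mulVec, dotProduct, schurLast, Matrix.of_apply, sub_mul,
      Finset.sum_sub_distrib, mul_sub, Finset.mul_sum]
    congr 1
    exact Finset.sum_congr rfl fun j _ => by ring
  have hQ : star (Fin.snoc x z : Fin (m + 1) → ℂ) ⬝ᵥ C *ᵥ (Fin.snoc x z : Fin (m + 1) → ℂ) =
      (∑ i, star (x i) * ∑ j, C i.castSucc j.castSucc * x j) + star b * z
        + star z * b + star z * a * z := by
    rw [hsb, hb, Finset.sum_mul]
    simp only [dotProduct, mulVec, Fin.sum_univ_castSucc, Pi.star_apply, Fin.snoc_castSucc,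
      Fin.snoc_last, mul_add, Finset.sum_add_distrib, ← ha]
    simp only [mul_assoc]
    ring
  have hn : ((‖z + b / a‖ ^ 2 : ℝ) : ℂ) = (star z + star b / a) * (z + b / a) := by
    rw [Complex.ofReal_pow, ← Complex.conj_mul']
    have : star (z + b / a) = star z + star b / a := by
      rw [star_add, star_div₀, hsa]
    rw [← this]; rfl
  rw [hQ, hS, hn]
  field_simp
  ring

theorem posDef_schurLast {m : ℕ} {C : Matrix (Fin (m + 1)) (Fin (m + 1)) ℂ} (hC : C.PosDef) :
    (schurLast C).PosDef := by
  have h : C (Fin.last m) (Fin.last m) ≠ 0 := hC.diag_pos.ne'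
  refine PosDef.of_dotProduct_mulVec_pos ?_ fun x hx => ?_
  · ext i j
    simp only [schurLast, conjTranspose_apply, Matrix.of_apply, star_sub, star_mul, star_inv₀,
      hC.1.apply]
    ring
  · have key := star_dotProduct_mulVec_snoc hC.1 h x
      (-((∑ j, C (Fin.last m) j.castSucc * x j) / C (Fin.last m) (Fin.last m)))
    rw [neg_add_cancel, norm_zero] at key
    simp only [ne_eq, OfNat.ofNat_ne_zero, not_false_eq_true, zero_pow, Complex.ofReal_zero,
      mul_zero, zero_add] at key
    rw [← key]
    refine hC.dotProduct_mulVec_pos fun h0 => hx ?_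
    ext i
    simpa using congrFun h0 i.castSucc

theorem hasDerivAt_inv_quadratic_pow {a s : ℝ} (ha : 0 < a) (hs : 0 < s) {m : ℕ} (hm : m ≠ 0)
    (r : ℝ) : HasDerivAt (fun r : ℝ => -(2 * a * m)⁻¹ * ((a * r ^ 2 + s) ^ m)⁻¹)
      (r * ((a * r ^ 2 + s) ^ (m + 1))⁻¹) r := by
  have hpos : 0 < a * r ^ 2 + s := by positivity
  have hq : HasDerivAt (fun r : ℝ => a * r ^ 2 + s) (a * (2 * r)) r := by
    simpa using ((hasDerivAt_pow 2 r).const_mul a).add_const s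
  refine (((hq.pow m).inv (pow_pos hpos m).ne').const_mul _).congr_deriv ?_
  obtain ⟨k, rfl⟩ := Nat.exists_eq_succ_of_ne_zero hm
  have : ((k.succ : ℕ) : ℝ) ≠ 0 := by positivity
  simp only [Nat.succ_eq_add_one, Nat.add_sub_cancel, Pi.pow_apply] at *
  field_simp
  ring

theorem lintegral_complex_inv_quadratic_pow {a s : ℝ} (ha : 0 < a) (hs : 0 < s) {m : ℕ}
    (hm : m ≠ 0) (c : ℂ) :
    ∫⁻ z : ℂ, ENNReal.ofReal ((a * ‖z + c‖ ^ 2 + s) ^ (m + 1))⁻¹ =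
      ENNReal.ofReal (Real.pi / (m * a) * (s ^ m)⁻¹) := by
  rw [lintegral_add_right_eq_self
    (fun z : ℂ => ENNReal.ofReal ((a * ‖z‖ ^ 2 + s) ^ (m + 1))⁻¹) c]
  have hlim : Filter.Tendsto (fun r : ℝ => -(2 * a * m)⁻¹ * ((a * r ^ 2 + s) ^ m)⁻¹)
      Filter.atTop (nhds 0) := by
    rw [← mul_zero (-(2 * a * m)⁻¹)]
    refine Filter.Tendsto.const_mul _ (Filter.Tendsto.inv_tendsto_atTop ?_)
    exact (Filter.tendsto_pow_atTop hm).comp (Filter.tendsto_atTop_add_const_right _ _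
      ((Filter.tendsto_pow_atTop two_ne_zero).const_mul_atTop ha))
  have hnn : ∀ r ∈ Set.Ioi (0 : ℝ), 0 ≤ r * ((a * r ^ 2 + s) ^ (m + 1))⁻¹ := fun r hr => by
    have : (0 : ℝ) < r := hr
    positivity
  have hd := fun r (_ : r ∈ Set.Ici (0 : ℝ)) => hasDerivAt_inv_quadratic_pow ha hs hm r
  have hint := integrableOn_Ioi_deriv_of_nonneg' hd hnn hlim
  have hval := integral_Ioi_of_hasDerivAt_of_nonneg' hd hnn hlim
  have hI : Integrable (fun z : ℂ => ((a * ‖z‖ ^ 2 + s) ^ (m + 1))⁻¹) := by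
    rw [integrable_fun_norm_addHaar volume (f := fun r : ℝ => ((a * r ^ 2 + s) ^ (m + 1))⁻¹)]
    simpa [Complex.finrank_real_complex] using hint
  rw [← ofReal_integral_eq_lintegral_ofReal hI (Filter.Eventually.of_forall fun z => by
    positivity),
    integral_fun_norm_addHaar volume (fun r : ℝ => ((a * r ^ 2 + s) ^ (m + 1))⁻¹)]
  congr 1
  simp only [Complex.finrank_real_complex, Nat.add_one_sub_one, pow_one, smul_eq_mul, hval,
    Measure.real, Complex.volume_ball]
  have : (m : ℝ) ≠ 0 := by exact_mod_cast hm
  simp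
  field_simp

theorem continuous_re_star_dotProduct_mulVec_cons {n : ℕ}
    (C : Matrix (Fin (n + 1)) (Fin (n + 1)) ℂ) :
    Continuous fun w : Fin n → ℂ =>
      (star (Fin.cons 1 w : Fin (n + 1) → ℂ) ⬝ᵥ C *ᵥ (Fin.cons 1 w : Fin (n + 1) → ℂ)).re := by
  have hc : Continuous fun w : Fin n → ℂ => (Fin.cons 1 w : Fin (n + 1) → ℂ) :=
    continuous_const.finCons continuous_id
  exact Complex.continuous_re.comp
    (hc.star.dotProduct (continuous_const.matrix_mulVec hc))

theorem lintegral_parabolic_fiber (n : ℕ) (C : Matrix (Fin (n + 1)) (Fin (n + 1)) ℂ)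
    (hC : C.PosDef) :
    ∫⁻ w : Fin n → ℂ, ENNReal.ofReal
        ((star (Fin.cons 1 w : Fin (n + 1) → ℂ) ⬝ᵥ
          C *ᵥ (Fin.cons 1 w : Fin (n + 1) → ℂ)).re ^ (n + 1))⁻¹ =
      ENNReal.ofReal (Real.pi ^ n / (Nat.factorial n * C.det.re)) := by
  induction n with
  | zero =>
    rw [lintegral_unique, volume_pi, Measure.pi_univ]
    simp [dotProduct, mulVec]
  | succ n ih =>
    set a := C (Fin.last (n + 1)) (Fin.last (n + 1)) with ha
    have hapos : 0 < a := hC.diag_pos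
    have hare : 0 < a.re := (Complex.pos_iff.1 hapos).1
    have haim : a.im = 0 := (Complex.pos_iff.1 hapos).2.symm
    have hS := posDef_schurLast hC
    have hdet : C.det.re = a.re * (schurLast C).det.re := by
      rw [det_eq_mul_det_schurLast C hapos.ne', Complex.mul_re, ← ha, haim]; ring
    let e := MeasurableEquiv.piFinSuccAbove (fun _ : Fin (n + 1) => ℂ) (Fin.last n)
    have he : MeasurePreserving e.symm :=
      (volume_preserving_piFinSuccAbove (fun _ : Fin (n + 1) => ℂ) (Fin.last n)).symm
    have hcons : ∀ p : ℂ × (Fin n → ℂ), (Fin.cons 1 (e.symm p) : Fin (n + 2) → ℂ) =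
        Fin.snoc (Fin.cons 1 p.2 : Fin (n + 1) → ℂ) p.1 := by
      intro p
      rw [← Fin.cons_snoc_eq_snoc_cons]
      congr 1
      exact Fin.insertNth_last' p.1 p.2
    have hmeas : Measurable fun w : Fin (n + 1) → ℂ => ENNReal.ofReal
        ((star (Fin.cons 1 w : Fin (n + 2) → ℂ) ⬝ᵥ
          C *ᵥ (Fin.cons 1 w : Fin (n + 2) → ℂ)).re ^ (n + 1 + 1))⁻¹ :=
      (((continuous_re_star_dotProduct_mulVec_cons C).measurable.pow_const _).inv).ennreal_ofReal
    have hinner : ∀ w : Fin n → ℂ, ∫⁻ z : ℂ, ENNReal.ofReal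
        ((star (Fin.cons 1 (e.symm (z, w)) : Fin (n + 2) → ℂ) ⬝ᵥ
          C *ᵥ (Fin.cons 1 (e.symm (z, w)) : Fin (n + 2) → ℂ)).re ^ (n + 1 + 1))⁻¹ =
        ENNReal.ofReal (Real.pi / ((n + 1 : ℕ) * a.re)) * ENNReal.ofReal
          ((star (Fin.cons 1 w : Fin (n + 1) → ℂ) ⬝ᵥ
            schurLast C *ᵥ (Fin.cons 1 w : Fin (n + 1) → ℂ)).re ^ (n + 1))⁻¹ := by
      intro w
      have hne : (Fin.cons 1 w : Fin (n + 1) → ℂ) ≠ 0 := fun h0 => by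
        simpa using congrFun h0 0
      have hs := (Complex.pos_iff.1 (hS.dotProduct_mulVec_pos hne)).1
      simp only [hcons, star_dotProduct_mulVec_snoc hC.1 hapos.ne', Complex.add_re,
        Complex.re_mul_ofReal, ← ha]
      rw [lintegral_complex_inv_quadratic_pow hare hs n.succ_ne_zero,
        ENNReal.ofReal_mul (by positivity)]
    rw [← he.lintegral_comp hmeas, Measure.volume_eq_prod]
    refine (lintegral_prod_symm' _ (hmeas.comp e.symm.measurable)).trans ?_
    simp only [Function.comp_apply, hinner]
    rw [lintegral_const_mul' _ _ ENNReal.ofReal_ne_top, ih _ hS,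
      ← ENNReal.ofReal_mul (by positivity), hdet]
    congr 1
    rw [div_mul_div_comm, Nat.factorial_succ, pow_succ']
    push_cast
    congr 1
    ring

/-- For a positive-definite Hermitian matrix `C` of size `(n+1) × (n+1)`, with
`v w = (1, w₁, …, wₙ)`, the function `w ↦ (v(w)* C v(w))^{-(n+1)}` is integrable on `ℂⁿ`
and its integral equals `πⁿ / (n! · det C)`. -/
theorem parabolic_fiber_integral_posdef (n : ℕ)
    (C : Matrix (Fin (n + 1)) (Fin (n + 1)) ℂ) (hC : C.PosDef) :
    Integrable (fun w : Fin n → ℂ =>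
      ((star (Fin.cons 1 w) ⬝ᵥ C.mulVec (Fin.cons 1 w)).re ^ (n + 1))⁻¹) volume ∧
    ∫ w : Fin n → ℂ,
        ((star (Fin.cons 1 w) ⬝ᵥ C.mulVec (Fin.cons 1 w)).re ^ (n + 1))⁻¹ =
      Real.pi ^ n / (Nat.factorial n * C.det.re) := by
  have hnn : ∀ w : Fin n → ℂ, 0 ≤
      ((star (Fin.cons 1 w) ⬝ᵥ C.mulVec (Fin.cons 1 w)).re ^ (n + 1))⁻¹ := fun w =>
    inv_nonneg.2 (pow_nonneg (Complex.nonneg_iff.1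
      (hC.posSemidef.dotProduct_mulVec_nonneg (Fin.cons 1 w))).1 _)
  have hmeas : Measurable fun w : Fin n → ℂ =>
      ((star (Fin.cons 1 w) ⬝ᵥ C.mulVec (Fin.cons 1 w)).re ^ (n + 1))⁻¹ :=
    ((continuous_re_star_dotProduct_mulVec_cons C).measurable.pow_const _).inv
  have hdet : 0 < C.det.re := (Complex.pos_iff.1 hC.det_pos).1
  have hval := lintegral_parabolic_fiber n C hC
  refine ⟨⟨hmeas.aestronglyMeasurable, ?_⟩, ?_⟩
  · rw [hasFiniteIntegral_iff_ofReal (Filter.Eventually.of_forall hnn)]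
    exact hval ▸ ENNReal.ofReal_lt_top
  · rw [integral_eq_lintegral_of_nonneg_ae (Filter.Eventually.of_forall hnn)
      hmeas.aestronglyMeasurable, hval, ENNReal.toReal_ofReal (by positivity)]
end

section
/- Let n ≥ 0 and let c_0, c_1, …, c_n be positive real numbers. Then ∫_{ℂⁿ} (c_0 + Σ_{i=1}^{n} c_i |w_i|²)^{-(n+1)} dλ(w) = πⁿ / (n! · c_0 c_1 ⋯ c_n), and in particular the integrand is integrable on ℂⁿ. -/
open MeasureTheory

lemma Complex.integral_exp_neg_mul_norm_sq {b : ℝ} (hb : 0 < b) :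
    ∫ z : ℂ, Real.exp (-b * ‖z‖ ^ 2) = Real.pi / b := by
  simpa using GaussianFourier.integral_rexp_neg_mul_sq_norm (V := ℂ) hb

lemma Complex.integrable_exp_neg_mul_norm_sq {b : ℝ} (hb : 0 < b) :
    Integrable fun z : ℂ => Real.exp (-b * ‖z‖ ^ 2) := by
  refine not_imp_comm.1 integral_undef ?_
  rw [Complex.integral_exp_neg_mul_norm_sq hb]
  positivity

lemma exp_neg_mul_add_sum_eq_mul_prod {n : ℕ} (t r : ℝ) (b : Fin n → ℝ) (w : Fin n → ℂ) :
    Real.exp (-((r + ∑ i, b i * ‖w i‖ ^ 2) * t)) =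
      Real.exp (-r * t) * ∏ i, Real.exp (-(t * b i) * ‖w i‖ ^ 2) := by
  rw [← Real.exp_sum, ← Real.exp_add]
  congr 1
  simp only [neg_mul, Finset.sum_neg_distrib, add_mul, Finset.sum_mul, neg_add]
  congr 2
  exact Finset.sum_congr rfl fun i _ => by ring

lemma integrable_exp_neg_mul_add_sum {n : ℕ} {t : ℝ} (ht : 0 < t) (r : ℝ) {b : Fin n → ℝ}
    (hb : ∀ i, 0 < b i) :
    Integrable fun w : Fin n → ℂ => Real.exp (-((r + ∑ i, b i * ‖w i‖ ^ 2) * t)) := by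
  simp only [exp_neg_mul_add_sum_eq_mul_prod]
  exact (Integrable.fintype_prod (f := fun i (z : ℂ) => Real.exp (-(t * b i) * ‖z‖ ^ 2))
    fun i => Complex.integrable_exp_neg_mul_norm_sq (mul_pos ht (hb i))).const_mul _

lemma pow_mul_integral_exp_neg_mul_add_sum {n : ℕ} {t : ℝ} (ht : 0 < t) (r : ℝ)
    {b : Fin n → ℝ} (hb : ∀ i, 0 < b i) :
    t ^ n * ∫ w : Fin n → ℂ, Real.exp (-((r + ∑ i, b i * ‖w i‖ ^ 2) * t)) =
      Real.pi ^ n / (∏ i, b i) * Real.exp (-r * t) := by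
  simp only [exp_neg_mul_add_sum_eq_mul_prod]
  rw [integral_const_mul, integral_fintype_prod_volume_eq_prod
    (fun i (z : ℂ) => Real.exp (-(t * b i) * ‖z‖ ^ 2)),
    Finset.prod_congr rfl fun i _ => Complex.integral_exp_neg_mul_norm_sq (mul_pos ht (hb i))]
  have hprod : ∏ i, b i ≠ 0 := Finset.prod_ne_zero_iff.2 fun i _ => (hb i).ne'
  simp only [Finset.prod_div_distrib, Finset.prod_mul_distrib, Finset.prod_const,
    Finset.card_univ, Fintype.card_fin]
  field_simp

lemma integral_pow_mul_exp_neg_mul_Ioi (n : ℕ) {r : ℝ} (hr : 0 < r) :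
    ∫ t in Set.Ioi (0 : ℝ), t ^ n * Real.exp (-(r * t)) = n.factorial * (r ^ (n + 1))⁻¹ := by
  have h := Real.integral_rpow_mul_exp_neg_mul_Ioi (a := (n : ℝ) + 1) (by positivity) hr
  simp only [add_sub_cancel_right, Real.rpow_natCast, Real.Gamma_nat_eq_factorial] at h
  rw [h, ← Nat.cast_succ, Real.rpow_natCast, one_div, inv_pow, mul_comm]

theorem parabolic_fiber_integral_diagonal (n : ℕ) (c : Fin (n + 1) → ℝ)
    (hc : ∀ i, 0 < c i) :
    Integrable (fun w : Fin n → ℂ =>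
      ((c 0 + ∑ i : Fin n, c i.succ * ‖w i‖ ^ 2) ^ (n + 1))⁻¹) volume ∧
    ∫ w : Fin n → ℂ,
        ((c 0 + ∑ i : Fin n, c i.succ * ‖w i‖ ^ 2) ^ (n + 1))⁻¹ =
      Real.pi ^ n / (Nat.factorial n * ∏ i : Fin (n + 1), c i) := by
  have hb : ∀ i : Fin n, 0 < c i.succ := fun i => hc _
  have hpos (w : Fin n → ℂ) : 0 < c 0 + ∑ i : Fin n, c i.succ * ‖w i‖ ^ 2 :=
    add_pos_of_pos_of_nonneg (hc 0)
      (Finset.sum_nonneg fun i _ => mul_nonneg (hb i).le (by positivity))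
  let F : ℝ → (Fin n → ℂ) → ℝ := fun t w =>
    t ^ n * Real.exp (-((c 0 + ∑ i : Fin n, c i.succ * ‖w i‖ ^ 2) * t))
  have hslice {t : ℝ} (ht : 0 < t) :
      ∫ w, F t w = Real.pi ^ n / (∏ i : Fin n, c i.succ) * Real.exp (-c 0 * t) := by
    rw [← pow_mul_integral_exp_neg_mul_add_sum ht (c 0) hb, ← integral_const_mul]
  have hexp : IntegrableOn (fun t => Real.exp (-c 0 * t)) (Set.Ioi 0) :=
    integrableOn_exp_mul_Ioi (neg_lt_zero.2 (hc 0)) 0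
  have hF : Integrable (Function.uncurry F) ((volume.restrict (Set.Ioi 0)).prod volume) := by
    have hcont : Continuous (Function.uncurry F) := by
      simp only [F, Function.uncurry_def]
      fun_prop
    refine (integrable_prod_iff hcont.aestronglyMeasurable).2 ⟨?_, ?_⟩
    · filter_upwards [ae_restrict_mem measurableSet_Ioi] with t ht
      exact (integrable_exp_neg_mul_add_sum ht (c 0) hb).const_mul (t ^ n)
    · refine (hexp.const_mul (Real.pi ^ n / ∏ i : Fin n, c i.succ)).congr ?_
      filter_upwards [ae_restrict_mem measurableSet_Ioi] with t ht
      rw [← hslice ht]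
      refine integral_congr_ae (.of_forall fun w => ?_)
      exact (Real.norm_of_nonneg
        (mul_nonneg (pow_nonneg (le_of_lt ht) n) (Real.exp_pos _).le)).symm
  have hgamma (w : Fin n → ℂ) : ((c 0 + ∑ i : Fin n, c i.succ * ‖w i‖ ^ 2) ^ (n + 1))⁻¹ =
      (n.factorial : ℝ)⁻¹ * ∫ t in Set.Ioi 0, F t w := by
    rw [integral_pow_mul_exp_neg_mul_Ioi n (hpos w), inv_mul_cancel_left₀ (by positivity)]
  simp only [hgamma]
  refine ⟨hF.integral_prod_right.const_mul _, ?_⟩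
  rw [integral_const_mul, ← integral_integral_swap hF,
    setIntegral_congr_fun measurableSet_Ioi fun t ht => hslice ht, integral_const_mul,
    integral_exp_mul_Ioi (neg_lt_zero.2 (hc 0)), Fin.prod_univ_succ]
  have hprod : ∏ i : Fin n, c i.succ ≠ 0 := Finset.prod_ne_zero_iff.2 fun i _ => (hb i).ne'
  have h0 := (hc 0).ne'
  simp
  field_simp
end

section
/- Let n ≥ 0, let C be a positive-definite Hermitian (n+1)×(n+1) complex matrix, and let U be a unitary (n+1)×(n+1) complex matrix. For w ∈ ℂⁿ let v(w) ∈ ℂ^{n+1} denote the vector with components v(w)_0 = 1 and v(w)_i = w_i for 1 ≤ i ≤ n. Then ∫_{ℂⁿ} (v(w)* U* C U v(w))^{-(n+1)} dλ(w) = ∫_{ℂⁿ} (v(w)* C v(w))^{-(n+1)} dλ(w). -/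
open MeasureTheory Matrix
open scoped ComplexOrder

/-- Change of variables for an invertible complex-linear endomorphism of `ℂⁿ`: the Jacobian is
the squared norm of the complex determinant. -/
theorem lintegral_eq_normSq_det_mul_lintegral_comp {n : ℕ}
    (A : (Fin n → ℂ) →ₗ[ℂ] (Fin n → ℂ)) (hA : LinearMap.det A ≠ 0)
    {f : (Fin n → ℂ) → ENNReal} (hf : Measurable f) :
    ∫⁻ z, f z = ENNReal.ofReal (Complex.normSq (LinearMap.det A)) * ∫⁻ z, f (A z) := by
  have hdet : LinearMap.det (A.restrictScalars ℝ) = Complex.normSq (LinearMap.det A) := by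
    rw [LinearMap.det_restrictScalars, Algebra.norm_complex_apply]
  have hpos : 0 < Complex.normSq (LinearMap.det A) := Complex.normSq_pos.2 hA
  have hmap := Measure.map_linearMap_addHaar_eq_smul_addHaar
    (volume : Measure (Fin n → ℂ)) (f := A.restrictScalars ℝ) (by rw [hdet]; exact hpos.ne')
  rw [hdet, abs_of_pos (inv_pos.2 hpos)] at hmap
  have hmeas : Measurable (A.restrictScalars ℝ) :=
    (LinearMap.continuous_of_finiteDimensional _).measurable
  have hcomp : ∫⁻ z, f (A z) = ∫⁻ z, f z ∂(Measure.map (A.restrictScalars ℝ) volume) :=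
    (lintegral_map hf hmeas).symm
  rw [hcomp, hmap, lintegral_smul_measure, smul_eq_mul, ← mul_assoc,
    ← ENNReal.ofReal_mul hpos.le, mul_inv_cancel₀ hpos.ne', ENNReal.ofReal_one, one_mul]

/-- Moments of a complex Gaussian. -/
theorem lintegral_norm_pow_mul_exp_neg (n : ℕ) {b : ℝ} (hb : 0 < b) :
    ∫⁻ t : ℂ, ENNReal.ofReal (‖t‖ ^ (2 * n) * Real.exp (-(‖t‖ ^ 2 * b))) =
      ENNReal.ofReal (Real.pi * n.factorial) * ENNReal.ofReal (b ^ (n + 1))⁻¹ := by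
  have hint : ∫ t : ℂ, ‖t‖ ^ (2 * n) * Real.exp (-(‖t‖ ^ 2 * b)) =
      Real.pi * n.factorial * (b ^ (n + 1))⁻¹ := by
    have h := Complex.integral_rpow_mul_exp_neg_mul_rpow (p := 2) (q := (2 * n : ℕ)) (b := b)
      (by norm_num) (lt_of_lt_of_le (by norm_num) (Nat.cast_nonneg _)) hb
    have h1 : (((2 * n : ℕ) : ℝ) + 2) / 2 = n + 1 := by push_cast; ring
    have h2 : b ^ (-(((2 * n : ℕ) : ℝ) + 2) / 2) = (b ^ (n + 1))⁻¹ := by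
      rw [neg_div, h1, Real.rpow_neg hb.le, ← Nat.cast_add_one, Real.rpow_natCast]
    rw [h2, h1, Real.Gamma_nat_eq_factorial] at h
    simp only [Real.rpow_natCast, Real.rpow_two] at h
    calc _ = ∫ t : ℂ, ‖t‖ ^ (2 * n) * Real.exp (-b * ‖t‖ ^ 2) := by
          congr 1; ext t; ring_nf
      _ = _ := by rw [h]; ring
  have hpos : 0 < Real.pi * n.factorial * (b ^ (n + 1))⁻¹ := by positivity
  rw [← ENNReal.ofReal_mul (by positivity), ← hint, ofReal_integral_eq_lintegral_ofReal]
  · exact Integrable.of_integral_ne_zero (by rw [hint]; exact hpos.ne')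
  · exact Filter.Eventually.of_forall fun t => by positivity

/-- The Gaussian integral of a function on `ℂⁿ⁺¹` that is homogeneous of degree two, computed in
the affine chart of projective space. -/
theorem lintegral_exp_neg_eq_mul_lintegral_affine_chart {n : ℕ} {q : (Fin (n + 1) → ℂ) → ℝ}
    (hq : Continuous q) (hpos : ∀ z, z ≠ 0 → 0 < q z)
    (hsmul : ∀ (c : ℂ) (z), q (c • z) = ‖c‖ ^ 2 * q z) :
    ∫⁻ z, ENNReal.ofReal (Real.exp (-q z)) =
      ENNReal.ofReal (Real.pi * n.factorial) *
        ∫⁻ w : Fin n → ℂ, ENNReal.ofReal ((q (Fin.cons 1 w) ^ (n + 1))⁻¹) := by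
  have hcons : Continuous fun p : ℂ × (Fin n → ℂ) => (Fin.cons p.1 p.2 : Fin (n + 1) → ℂ) :=
    Continuous.finCons (A := fun _ => ℂ) continuous_fst continuous_snd
  have hcons1 : Continuous fun w : Fin n → ℂ => (Fin.cons 1 w : Fin (n + 1) → ℂ) :=
    continuous_const.finCons continuous_id
  have hne (w : Fin n → ℂ) : (Fin.cons 1 w : Fin (n + 1) → ℂ) ≠ 0 := fun h => by
    simpa using congrFun h 0
  have hF : Measurable fun p : ℂ × (Fin n → ℂ) =>
      ENNReal.ofReal (Real.exp (-q (Fin.cons p.1 p.2))) :=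
    (Real.continuous_exp.comp (hq.comp hcons).neg).measurable.ennreal_ofReal
  have hG : Measurable fun p : ℂ × (Fin n → ℂ) =>
      ENNReal.ofReal (‖p.1‖ ^ (2 * n) * Real.exp (-(‖p.1‖ ^ 2 * q (Fin.cons 1 p.2)))) := by
    refine Measurable.ennreal_ofReal (Continuous.measurable ?_)
    have := hq.comp (hcons1.comp (continuous_snd (X := ℂ)))
    simp only [Function.comp_def] at this
    fun_prop
  have hfiber (t : ℂ) (ht : t ≠ 0) :
      ∫⁻ w : Fin n → ℂ, ENNReal.ofReal (Real.exp (-q (Fin.cons t w))) =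
      ∫⁻ w : Fin n → ℂ, ENNReal.ofReal
        (‖t‖ ^ (2 * n) * Real.exp (-(‖t‖ ^ 2 * q (Fin.cons 1 w)))) := by
    have hdet : LinearMap.det (t • (LinearMap.id : (Fin n → ℂ) →ₗ[ℂ] _)) = t ^ n := by
      simp
    rw [lintegral_eq_normSq_det_mul_lintegral_comp (t • LinearMap.id)
      (by rw [hdet]; exact pow_ne_zero _ ht)
      (f := fun w => ENNReal.ofReal (Real.exp (-q (Fin.cons t w))))
      (hF.comp measurable_prodMk_left), hdet,
      ← lintegral_const_mul' _ _ ENNReal.ofReal_ne_top]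
    refine lintegral_congr fun w => ?_
    have hz : (Fin.cons t (t • w) : Fin (n + 1) → ℂ) = t • Fin.cons 1 w := by
      ext i; refine Fin.cases ?_ (fun j => ?_) i <;> simp
    simp only [LinearMap.smul_apply, LinearMap.id_apply, hz, hsmul]
    rw [← ENNReal.ofReal_mul (Complex.normSq_nonneg _), Complex.normSq_eq_norm_sq, norm_pow,
      ← pow_mul, mul_comm n 2]
  calc ∫⁻ z, ENNReal.ofReal (Real.exp (-q z))
      = ∫⁻ p : ℂ × (Fin n → ℂ), ENNReal.ofReal (Real.exp (-q (Fin.cons p.1 p.2))) := by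
        rw [← ((volume_preserving_piFinSuccAbove (fun _ : Fin (n + 1) => ℂ) 0).symm
          _).lintegral_comp_emb (MeasurableEquiv.measurableEmbedding _)]
        refine lintegral_congr fun p => ?_
        simp [MeasurableEquiv.piFinSuccAbove_symm_apply, Fin.insertNthEquiv]
    _ = ∫⁻ t : ℂ, ∫⁻ w : Fin n → ℂ, ENNReal.ofReal (Real.exp (-q (Fin.cons t w))) :=
        lintegral_prod _ hF.aemeasurable
    _ = ∫⁻ t : ℂ, ∫⁻ w : Fin n → ℂ, ENNReal.ofReal
          (‖t‖ ^ (2 * n) * Real.exp (-(‖t‖ ^ 2 * q (Fin.cons 1 w)))) := by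
        refine lintegral_congr_ae ?_
        filter_upwards [Measure.ae_ne volume (0 : ℂ)] with t ht using hfiber t ht
    _ = ∫⁻ w : Fin n → ℂ, ∫⁻ t : ℂ, ENNReal.ofReal
          (‖t‖ ^ (2 * n) * Real.exp (-(‖t‖ ^ 2 * q (Fin.cons 1 w)))) :=
        lintegral_lintegral_swap hG.aemeasurable
    _ = _ := by
        rw [← lintegral_const_mul' _ _ ENNReal.ofReal_ne_top]
        exact lintegral_congr fun w => lintegral_norm_pow_mul_exp_neg n (hpos _ (hne w))

/-- The fiber integral of a positive-definite Hermitian form is a Gaussian integral. -/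
theorem Matrix.PosDef.fiber_integral_eq {n : ℕ} {C : Matrix (Fin (n + 1)) (Fin (n + 1)) ℂ}
    (hC : C.PosDef) :
    ∫ w : Fin n → ℂ,
        ((star (Fin.cons 1 w) ⬝ᵥ C.mulVec (Fin.cons 1 w)).re ^ (n + 1))⁻¹ =
      ((ENNReal.ofReal (Real.pi * n.factorial))⁻¹ *
        ∫⁻ z : Fin (n + 1) → ℂ,
          ENNReal.ofReal (Real.exp (-(star z ⬝ᵥ C.mulVec z).re))).toReal := by
  have hcont : Continuous fun z : Fin (n + 1) → ℂ => (star z ⬝ᵥ C.mulVec z).re := by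
    fun_prop
  have hpos (z : Fin (n + 1) → ℂ) (hz : z ≠ 0) : 0 < (star z ⬝ᵥ C.mulVec z).re :=
    hC.re_dotProduct_pos hz
  have hne (w : Fin n → ℂ) : (Fin.cons 1 w : Fin (n + 1) → ℂ) ≠ 0 := fun h => by
    simpa using congrFun h 0
  have hcons : Continuous fun w : Fin n → ℂ => (Fin.cons 1 w : Fin (n + 1) → ℂ) :=
    continuous_const.finCons continuous_id
  have hsmul (c : ℂ) (z : Fin (n + 1) → ℂ) :
      (star (c • z) ⬝ᵥ C.mulVec (c • z)).re = ‖c‖ ^ 2 * (star z ⬝ᵥ C.mulVec z).re := by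
    rw [star_smul, mulVec_smul, smul_dotProduct, dotProduct_smul, smul_smul, smul_eq_mul,
      Complex.star_def, Complex.conj_mul', ← Complex.ofReal_pow, Complex.re_ofReal_mul]
  rw [lintegral_exp_neg_eq_mul_lintegral_affine_chart hcont hpos hsmul, ← mul_assoc,
    ENNReal.inv_mul_cancel (by rw [Ne, ENNReal.ofReal_eq_zero, not_le]; positivity)
      ENNReal.ofReal_ne_top, one_mul]
  refine integral_eq_lintegral_of_nonneg_ae
    (Filter.Eventually.of_forall fun w => inv_nonneg.2 (pow_pos (hpos _ (hne w)) _).le) ?_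
  exact (((hcont.comp hcons).pow (n + 1)).inv₀
    fun w => (pow_pos (hpos _ (hne w)) _).ne').aestronglyMeasurable

/-- Unitary invariance of the fiber integral: for a positive-definite Hermitian matrix `C`
and a unitary matrix `U` of size `(n+1) × (n+1)`, with `v w = (1, w₁, …, wₙ)`,
`∫_{ℂⁿ} (v(w)* U* C U v(w))^{-(n+1)} dλ(w) = ∫_{ℂⁿ} (v(w)* C v(w))^{-(n+1)} dλ(w)`. -/
theorem fiber_integral_unitary_invariance (n : ℕ)
    (C U : Matrix (Fin (n + 1)) (Fin (n + 1)) ℂ) (hC : C.PosDef)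
    (hU : Uᴴ * U = 1) :
    ∫ w : Fin n → ℂ,
        ((star (Fin.cons 1 w) ⬝ᵥ (Uᴴ * C * U).mulVec (Fin.cons 1 w)).re ^ (n + 1))⁻¹ =
    ∫ w : Fin n → ℂ,
        ((star (Fin.cons 1 w) ⬝ᵥ C.mulVec (Fin.cons 1 w)).re ^ (n + 1))⁻¹ := by
  have hnormSq : Complex.normSq U.det = 1 := by
    have h := congrArg Matrix.det hU
    rw [det_mul, det_conjTranspose, det_one, Complex.star_def, ← Complex.normSq_eq_conj_mul_self]
      at h
    exact_mod_cast h
  have hdet : LinearMap.det U.mulVecLin = U.det := LinearMap.det_toLin' U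
  have hUdet : U.det ≠ 0 := fun h => by simp [h] at hnormSq
  have hUC : (Uᴴ * C * U).PosDef :=
    hC.conjTranspose_mul_mul_same (mulVec_injective_of_isUnit
      ((isUnit_iff_isUnit_det _).2 hUdet.isUnit))
  have hmeas : Measurable fun z : Fin (n + 1) → ℂ =>
      ENNReal.ofReal (Real.exp (-(star z ⬝ᵥ C.mulVec z).re)) := by
    refine Measurable.ennreal_ofReal (Continuous.measurable ?_)
    fun_prop
  rw [hUC.fiber_integral_eq, hC.fiber_integral_eq,
    lintegral_eq_normSq_det_mul_lintegral_comp U.mulVecLin (by rwa [hdet]) hmeas, hdet, hnormSq,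
    ENNReal.ofReal_one, one_mul]
  simp only [mulVecLin_apply, star_mulVec, ← dotProduct_mulVec, mulVec_mulVec, Matrix.mul_assoc]
end
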